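/- arXiv:1905.06627 — 4 statements merged into one kernel-verified Lean document; each statement's English description precedes it below -/
import Mathlib

section
/- The belief function can be computed recursively over the length of paths: (i) for every state s with Σ_{s' : obs(s') = obs(s)} μ0(s') > 0, the belief in the length-one path (s) satisfies be((s)) = μ0(s) / Σ_{s' : obs(s') = obs(s)} μ0(s'); (ii) for every finite path w = (s_0,…,s_k) with Σ_{w' observationally equivalent to w} W(w') > 0 and every state t such that D = Σ_{w' observationally equivalent to w} Σ_{s : obs(s) = obs(t)} be(w')·T(last(w'), s) > 0, the belief in the extended path w·t satisfies be(w·t) = be(w)·T(s_k, t) / D. -/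
/-- The weight of a finite path `w = (s_0,…,s_n)`:
`W(w) = μ0(s_0) · ∏_{i=0}^{n-1} T(s_i, s_{i+1})`. -/
noncomputable def pathWeight {S : Type*} (μ0 : S → ℝ) (T : S → S → ℝ)
    {n : ℕ} (w : Fin (n + 1) → S) : ℝ :=
  μ0 (w 0) * ∏ i : Fin n, T (w i.castSucc) (w i.succ)

/-- The observation class of a finite path `w`: the finite paths of the same length that are
observationally equivalent to `w`. -/
def obsClass {S O : Type*} [Fintype S] [DecidableEq O] (obs : S → O)
    {n : ℕ} (w : Fin (n + 1) → S) : Finset (Fin (n + 1) → S) :=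
  Finset.univ.filter (fun w' => ∀ i, obs (w' i) = obs (w i))

/-- The belief in a finite path `w`: `be(w) = W(w) / Σ_{w' obs-equivalent to w} W(w')`. -/
noncomputable def belief {S O : Type*} [Fintype S] [DecidableEq O] (obs : S → O)
    (μ0 : S → ℝ) (T : S → S → ℝ) {n : ℕ} (w : Fin (n + 1) → S) : ℝ :=
  pathWeight μ0 T w / ∑ w' ∈ obsClass obs w, pathWeight μ0 T w'

theorem pathWeight_snoc {S : Type*} (μ0 : S → ℝ) (T : S → S → ℝ) {n : ℕ}
    (w : Fin (n + 1) → S) (t : S) :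
    pathWeight μ0 T (Fin.snoc w t : Fin (n + 2) → S) =
      pathWeight μ0 T w * T (w (Fin.last n)) t := by
  have h0 : (Fin.snoc w t : Fin (n + 2) → S) 0 = w 0 :=
    Fin.snoc_castSucc (α := fun _ => S) t w 0
  simp only [pathWeight, h0, Fin.prod_univ_castSucc (n := n), Fin.snoc_castSucc, Fin.succ_last,
    Fin.snoc_last, Fin.succ_castSucc, mul_assoc]

theorem sum_obsClass_snoc {S O M : Type*} [Fintype S] [DecidableEq O] [AddCommMonoid M]
    (obs : S → O) {n : ℕ} (w : Fin (n + 1) → S) (t : S) (f : (Fin (n + 2) → S) → M) :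
    ∑ v ∈ obsClass obs (Fin.snoc w t : Fin (n + 2) → S), f v =
      ∑ w' ∈ obsClass obs w, ∑ s ∈ Finset.univ.filter (fun s => obs s = obs t),
        f (Fin.snoc w' s : Fin (n + 2) → S) := by
  rw [← Finset.sum_product']
  refine Finset.sum_nbij' (fun v => (Fin.init v, v (Fin.last (n + 1))))
    (fun p => Fin.snoc p.1 p.2) ?_ ?_ ?_ ?_ ?_ <;>
    simp +contextual [obsClass, Fin.forall_fin_succ' (n := n + 1), Fin.init]

/-- The belief function can be computed recursively over the length of paths:
(i) for every state `s` with `Σ_{s' : obs(s') = obs(s)} μ0(s') > 0`, the belief in the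
length-one path `(s)` satisfies `be((s)) = μ0(s) / Σ_{s' : obs(s') = obs(s)} μ0(s')`;
(ii) for every finite path `w = (s_0,…,s_k)` with `Σ_{w' ~ w} W(w') > 0` and every state
`t` such that `D = Σ_{w' ~ w} Σ_{s : obs(s) = obs(t)} be(w')·T(last(w'), s) > 0`, the belief
in the extended path `w·t` satisfies `be(w·t) = be(w)·T(s_k, t) / D`. -/
theorem stmt3 {S O : Type*} [Fintype S] [Fintype O] [Nonempty S] [DecidableEq O]
    (obs : S → O)
    (μ0 : S → ℝ) (hμ0 : ∀ s, 0 ≤ μ0 s) (hμ0sum : ∑ s, μ0 s = 1)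
    (T : S → S → ℝ) (hT : ∀ s s', 0 ≤ T s s') (hTsum : ∀ s, ∑ s', T s s' = 1) :
    (∀ s : S, 0 < ∑ s' ∈ Finset.univ.filter (fun s' => obs s' = obs s), μ0 s' →
      belief obs μ0 T (fun _ : Fin 1 => s) =
        μ0 s / ∑ s' ∈ Finset.univ.filter (fun s' => obs s' = obs s), μ0 s') ∧
    (∀ (k : ℕ) (w : Fin (k + 1) → S) (t : S),
      0 < ∑ w' ∈ obsClass obs w, pathWeight μ0 T w' →
      0 < ∑ w' ∈ obsClass obs w, ∑ s ∈ Finset.univ.filter (fun s => obs s = obs t),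
            belief obs μ0 T w' * T (w' (Fin.last k)) s →
      belief obs μ0 T (Fin.snoc w t : Fin (k + 2) → S) =
        belief obs μ0 T w * T (w (Fin.last k)) t /
          ∑ w' ∈ obsClass obs w, ∑ s ∈ Finset.univ.filter (fun s => obs s = obs t),
            belief obs μ0 T w' * T (w' (Fin.last k)) s) := by
  refine ⟨fun s _ => ?_, fun k w t hw _ => ?_⟩
  · unfold belief
    congr 1
    · simp [pathWeight]
    · refine Finset.sum_equiv (Equiv.funUnique (Fin 1) S) ?_ ?_ <;>
        simp [obsClass, pathWeight]
  · have hD : ∑ w' ∈ obsClass obs w, ∑ s ∈ Finset.univ.filter (fun s => obs s = obs t),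
        belief obs μ0 T w' * T (w' (Fin.last k)) s =
        (∑ v ∈ obsClass obs (Fin.snoc w t : Fin (k + 2) → S), pathWeight μ0 T v) /
          ∑ w' ∈ obsClass obs w, pathWeight μ0 T w' := by
      rw [sum_obsClass_snoc, Finset.sum_div]
      refine Finset.sum_congr rfl fun w' hw' => ?_
      have hclass : obsClass obs w' = obsClass obs w := by
        simp only [obsClass, Finset.mem_filter_univ] at hw' ⊢
        simp only [hw']
      rw [Finset.sum_div]
      refine Finset.sum_congr rfl fun s _ => ?_
      rw [pathWeight_snoc, belief, hclass, div_mul_eq_mul_div]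
    rw [hD, belief, belief, pathWeight_snoc, div_mul_eq_mul_div, div_div_div_cancel_right₀ hw.ne']
end

section
/- Assume μ0(s) > 0 for every s ∈ S. Then the following are equivalent: (a) the agent has sure beliefs, i.e., for every finite path w with W(w) > 0 one has be(w) = 0 or be(w) = 1; (b) the agent has full observation, i.e., the observation function obs is injective. -/
/-- Assume `μ0(s) > 0` for every state `s`.  Then the following are equivalent:
(a) the agent has sure beliefs, i.e., for every finite path `w` with `W(w) > 0` one has
`be(w) = 0` or `be(w) = 1`; (b) the agent has full observation, i.e., the observation
function `obs` is injective. -/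
theorem stmt4 {S O : Type*} [Fintype S] [Fintype O] [Nonempty S] [DecidableEq O]
    (obs : S → O)
    (μ0 : S → ℝ) (hμ0 : ∀ s, 0 ≤ μ0 s) (hμ0sum : ∑ s, μ0 s = 1)
    (T : S → S → ℝ) (hT : ∀ s s', 0 ≤ T s s') (hTsum : ∀ s, ∑ s', T s s' = 1)
    (hμ0pos : ∀ s, 0 < μ0 s) :
    (∀ (n : ℕ) (w : Fin (n + 1) → S), 0 < pathWeight μ0 T w →
        belief obs μ0 T w = 0 ∨ belief obs μ0 T w = 1) ↔
      Function.Injective obs := by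
  classical
  constructor
  · intro h s t hst
    by_contra hne
    have hw : ∀ x : S, pathWeight μ0 T (fun _ : Fin (0 + 1) => x) = μ0 x := fun x => by
      simp [pathWeight]
    have hlt : μ0 s < ∑ w' ∈ obsClass obs (fun _ : Fin (0 + 1) => s), pathWeight μ0 T w' := by
      rw [← hw s]
      refine Finset.single_lt_sum (i := fun _ => s) (j := fun _ => t) ?_ ?_ ?_ ?_ ?_
      · intro hts
        exact hne (congrFun hts 0).symm
      · simp [obsClass]
      · simp [obsClass, hst]
      · rw [hw]
        exact hμ0pos t
      · intro w' _ _
        simpa [pathWeight] using hμ0 (w' 0)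
    have hpos := (hμ0pos s).trans hlt
    rcases h 0 (fun _ => s) (by rw [hw]; exact hμ0pos s) with hb | hb
    · rw [belief, hw] at hb
      exact (div_pos (hμ0pos s) hpos).ne' hb
    · rw [belief, hw, div_eq_one_iff_eq hpos.ne'] at hb
      exact hlt.ne hb
  · intro hinj n w hpos
    right
    have hclass : obsClass obs w = {w} := by
      ext w'
      simp [obsClass, hinj.eq_iff, funext_iff]
    rw [belief, hclass, Finset.sum_singleton, div_self hpos.ne']
end

section
/- Every row-stochastic matrix P on a nonempty finite set Q admits a stationary distribution; that is, there exists π : Q → ℝ with π(i) ≥ 0 for all i, Σ_{i∈Q} π(i) = 1, and Σ_{i∈Q} π(i)·P(i,j) = π(j) for every j ∈ Q. -/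
/-- Every row-stochastic matrix `P` on a nonempty finite set `Q` admits a stationary
distribution; that is, there exists `π : Q → ℝ` with `π(i) ≥ 0` for all `i`,
`Σ_i π(i) = 1`, and `Σ_i π(i)·P(i,j) = π(j)` for every `j`. -/
theorem stmt7 {Q : Type*} [Fintype Q] [Nonempty Q]
    (P : Q → Q → ℝ) (hP : ∀ i j, 0 ≤ P i j) (hPsum : ∀ i, ∑ j, P i j = 1) :
    ∃ π : Q → ℝ, (∀ i, 0 ≤ π i) ∧ (∑ i, π i = 1) ∧ (∀ j, ∑ i, π i * P i j = π j) := by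
  classical
  obtain ⟨v, hv0, hv⟩ : ∃ v : Q → ℝ, v ≠ 0 ∧ ∀ j, ∑ i, v i * P i j = v j := by
    have hdet : (Matrix.of P - 1).det = 0 := by
      refine Matrix.exists_mulVec_eq_zero_iff.mp ⟨fun _ => 1, ?_, ?_⟩
      · exact fun h => one_ne_zero (congrFun h (Classical.arbitrary Q))
      · ext i
        simp [Matrix.mulVec, dotProduct, Matrix.one_apply, hPsum]
    obtain ⟨v, hv0, hv⟩ := Matrix.exists_vecMul_eq_zero_iff.mpr hdet
    refine ⟨v, hv0, fun j => ?_⟩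
    rw [Matrix.vecMul_sub, Matrix.vecMul_one, sub_eq_zero] at hv
    exact congrFun hv j
  have hle : ∀ j ∈ Finset.univ, |v j| ≤ ∑ i, |v i| * P i j := fun j _ => by
    calc |v j| = |∑ i, v i * P i j| := by rw [hv]
      _ ≤ ∑ i, |v i * P i j| := Finset.abs_sum_le_sum_abs _ _
      _ = ∑ i, |v i| * P i j := by simp only [abs_mul, abs_of_nonneg (hP _ _)]
  have hsum : ∑ j, |v j| = ∑ j, ∑ i, |v i| * P i j := by
    rw [Finset.sum_comm]
    simp only [← Finset.mul_sum, hPsum, mul_one]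
  have habs := (Finset.sum_eq_sum_iff_of_le hle).mp hsum
  obtain ⟨k, hk⟩ := Function.ne_iff.mp hv0
  have hpos : 0 < ∑ i, |v i| :=
    Finset.sum_pos' (fun i _ => abs_nonneg _) ⟨k, Finset.mem_univ k, abs_pos.mpr hk⟩
  refine ⟨fun i => |v i| / ∑ l, |v l|, fun i => by positivity, ?_, fun j => ?_⟩
  · rw [← Finset.sum_div, div_self hpos.ne']
  · simp only [div_mul_eq_mul_div]
    rw [← Finset.sum_div, ← habs j (Finset.mem_univ j)]
end

section
/- If P is an irreducible row-stochastic matrix on a nonempty finite set Q, then P has exactly one stationary distribution: there exists a unique π : Q → ℝ with π(i) ≥ 0 for all i, Σ_{i∈Q} π(i) = 1, and Σ_{i∈Q} π(i)·P(i,j) = π(j) for every j ∈ Q. -/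
open Matrix in
theorem Matrix.abs_vecMul_eq_of_vecMul_eq {Q : Type*} [Fintype Q]
    {P : Matrix Q Q ℝ} (hP : ∀ i j, 0 ≤ P i j) (hPsum : ∀ i, ∑ j, P i j = 1)
    {v : Q → ℝ} (hv : v ᵥ* P = v) : |v| ᵥ* P = |v| := by
  have hle : ∀ j ∈ Finset.univ, |v| j ≤ (|v| ᵥ* P) j := by
    intro j _
    calc |v| j = |∑ i, v i * P i j| := by
          rw [Pi.abs_apply]
          exact congrArg abs (congrFun hv j).symm
      _ ≤ ∑ i, |v i * P i j| := Finset.abs_sum_le_sum_abs _ _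
      _ = (|v| ᵥ* P) j := by
          simp [vecMul, dotProduct, abs_mul, abs_of_nonneg (hP _ _)]
  have hsum : ∑ j, |v| j = ∑ j, (|v| ᵥ* P) j := by
    simp only [vecMul, dotProduct]
    rw [Finset.sum_comm]
    simp [← Finset.mul_sum, hPsum]
  funext j
  exact ((Finset.sum_eq_sum_iff_of_le hle).1 hsum j (Finset.mem_univ j)).symm

open Matrix in
theorem Matrix.pos_of_vecMul_eq_of_irreducible {Q : Type*} [Fintype Q] [DecidableEq Q]
    {P : Matrix Q Q ℝ} (hP : ∀ i j, 0 ≤ P i j)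
    (hirr : ∀ i j, ∃ k : ℕ, 1 ≤ k ∧ 0 < (P ^ k) i j)
    {u : Q → ℝ} (hu : u ᵥ* P = u) (hu0 : 0 ≤ u) (hne : u ≠ 0) (j : Q) : 0 < u j := by
  obtain ⟨i, hi⟩ := Function.ne_iff.1 hne
  obtain ⟨k, -, hk⟩ := hirr i j
  have hpow : ∀ n : ℕ, u ᵥ* P ^ n = u ∧ ∀ a b, 0 ≤ (P ^ n) a b := by
    intro n
    induction n with
    | zero =>
      refine ⟨by simp, fun a b => ?_⟩
      rw [pow_zero, one_apply]
      split_ifs <;> norm_num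
    | succ n ih =>
      refine ⟨by rw [pow_succ, ← vecMul_vecMul, ih.1, hu], fun a b => ?_⟩
      rw [pow_succ, mul_apply]
      exact Finset.sum_nonneg fun c _ => mul_nonneg (ih.2 a c) (hP c b)
  rw [← congrFun (hpow k).1 j]
  exact Finset.sum_pos' (fun a _ => mul_nonneg (hu0 a) ((hpow k).2 a j))
    ⟨i, Finset.mem_univ i, mul_pos (lt_of_le_of_ne (hu0 i) (Ne.symm hi)) hk⟩

open Matrix in
theorem Matrix.exists_ne_zero_vecMul_eq {Q : Type*} [Fintype Q] [Nonempty Q] [DecidableEq Q]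
    {P : Matrix Q Q ℝ} (hPsum : ∀ i, ∑ j, P i j = 1) :
    ∃ v : Q → ℝ, v ≠ 0 ∧ v ᵥ* P = v := by
  have hdet : (P - 1).det = 0 := by
    refine exists_mulVec_eq_zero_iff.1 ⟨1, one_ne_zero, ?_⟩
    funext i
    rw [sub_mulVec, one_mulVec]
    simp [mulVec, dotProduct, hPsum]
  obtain ⟨v, hv, h⟩ := exists_vecMul_eq_zero_iff.2 hdet
  exact ⟨v, hv, by simpa [vecMul_sub, sub_eq_zero] using h⟩

open Matrix in
theorem Matrix.eq_zero_of_vecMul_eq_of_sum_eq_zero {Q : Type*} [Fintype Q] [Nonempty Q]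
    [DecidableEq Q] {P : Matrix Q Q ℝ} (hP : ∀ i j, 0 ≤ P i j) (hPsum : ∀ i, ∑ j, P i j = 1)
    (hirr : ∀ i j, ∃ k : ℕ, 1 ≤ k ∧ 0 < (P ^ k) i j)
    {d : Q → ℝ} (hd : d ᵥ* P = d) (hsum : ∑ i, d i = 0) : d = 0 := by
  have hfix : (|d| + d) ᵥ* P = |d| + d := by
    rw [add_vecMul, abs_vecMul_eq_of_vecMul_eq hP hPsum hd, hd]
  have hnonneg : 0 ≤ |d| + d := fun i => by
    have := neg_abs_le (d i)
    simp only [Pi.zero_apply, Pi.add_apply, Pi.abs_apply]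
    linarith
  by_cases h0 : |d| + d = 0
  · have hnonpos : ∀ i ∈ Finset.univ, d i ≤ 0 := fun i _ => by
      have h := congrFun h0 i
      simp only [Pi.zero_apply, Pi.add_apply, Pi.abs_apply] at h
      linarith [abs_nonneg (d i)]
    funext i
    exact (Finset.sum_eq_zero_iff_of_nonpos hnonpos).1 hsum i (Finset.mem_univ i)
  · have hpos : ∀ i ∈ Finset.univ, 0 < d i := fun i _ => by
      have h := pos_of_vecMul_eq_of_irreducible hP hirr hfix hnonneg h0 i
      simp only [Pi.add_apply, Pi.abs_apply] at h
      by_contra hle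
      rw [abs_of_nonpos (not_lt.1 hle)] at h
      linarith
    exact absurd hsum.symm (Finset.sum_pos hpos Finset.univ_nonempty).ne

/-- If `P` is an irreducible row-stochastic matrix on a nonempty finite set `Q` (i.e. for
all `i, j` there exists `k ≥ 1` with `(P^k)(i,j) > 0`), then `P` has exactly one stationary
distribution: there exists a unique `π : Q → ℝ` with `π(i) ≥ 0` for all `i`,
`Σ_i π(i) = 1`, and `Σ_i π(i)·P(i,j) = π(j)` for every `j`. -/
theorem stmt8 {Q : Type*} [Fintype Q] [Nonempty Q] [DecidableEq Q]
    (P : Matrix Q Q ℝ) (hP : ∀ i j, 0 ≤ P i j) (hPsum : ∀ i, ∑ j, P i j = 1)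
    (hirr : ∀ i j, ∃ k : ℕ, 1 ≤ k ∧ 0 < (P ^ k) i j) :
    ∃! π : Q → ℝ,
      (∀ i, 0 ≤ π i) ∧ (∑ i, π i = 1) ∧ (∀ j, ∑ i, π i * P i j = π j) := by
  obtain ⟨v, hv0, hv⟩ := Matrix.exists_ne_zero_vecMul_eq hPsum
  have habs := Matrix.abs_vecMul_eq_of_vecMul_eq hP hPsum hv
  have hpos : 0 < ∑ i, |v i| := by
    obtain ⟨i, hi⟩ := Function.ne_iff.1 hv0
    exact Finset.sum_pos' (fun a _ => abs_nonneg _) ⟨i, Finset.mem_univ i, abs_pos.2 hi⟩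
  refine ⟨fun i => |v i| / ∑ i, |v i|, ⟨fun i => by positivity, ?_, fun j => ?_⟩, ?_⟩
  · rw [← Finset.sum_div, div_self hpos.ne']
  · have h : ∑ i, |v i| * P i j = |v j| := congrFun habs j
    simp only [div_mul_eq_mul_div]
    rw [← Finset.sum_div, h]
  · rintro ρ ⟨-, hρsum, hρ⟩
    refine sub_eq_zero.1 (Matrix.eq_zero_of_vecMul_eq_of_sum_eq_zero hP hPsum hirr ?_ ?_)
    · rw [Matrix.sub_vecMul]
      congr 1
      · exact funext hρ
      · funext j
        have h : ∑ i, |v i| * P i j = |v j| := congrFun habs j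
        simp only [Matrix.vecMul, dotProduct, div_mul_eq_mul_div]
        rw [← Finset.sum_div, h]
    · simp only [Pi.sub_apply, Finset.sum_sub_distrib, hρsum]
      rw [← Finset.sum_div, div_self hpos.ne', sub_self]
end
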